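/- arXiv:1501.07395 — 2 statements merged into one kernel-verified Lean document; each statement's English description precedes it below -/
import Mathlib

section
/- Let (R,m) be a one-dimensional Cohen–Macaulay Noetherian local ring with minimal multiplicity. Let B = R[X]_{(m,X)}, the localization of the polynomial ring R[X] at the maximal ideal generated by m and X. Then B is a two-dimensional Cohen–Macaulay Noetherian local ring with minimal multiplicity. -/
open IsLocalRing Polynomial

/-- The depth of `M` with respect to the ideal `I`: the supremum of lengths of
`M`-regular sequences consisting of elements of `I`. -/
noncomputable def seqDepth (R : Type*) (M : Type*) [CommRing R] [AddCommGroup M]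
    [Module R M] (I : Ideal R) : ℕ∞ :=
  sSup {n : ℕ∞ | ∃ rs : List R, (rs.length : ℕ∞) = n ∧ (∀ x ∈ rs, x ∈ I) ∧
    RingTheory.Sequence.IsRegular M rs}

/-- A `d`-dimensional Cohen–Macaulay local ring has minimal multiplicity if there is a
system of parameters `x₁, …, x_d` with `𝔫² = (x₁, …, x_d)·𝔫`. -/
def HasMinimalMultiplicity (R : Type*) [CommRing R] [IsLocalRing R] (d : ℕ) : Prop :=
  ∃ x : Fin d → R, (∀ i, x i ∈ maximalIdeal R) ∧
    (maximalIdeal R) ^ 2 = Ideal.span (Set.range x) * maximalIdeal R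

theorem HasMinimalMultiplicity.ringKrullDim_le {R : Type*} [CommRing R] [IsNoetherianRing R]
    [IsLocalRing R] {d : ℕ} (h : HasMinimalMultiplicity R d) : ringKrullDim R ≤ d := by
  obtain ⟨x, hx, hsq⟩ := h
  have hle : Ideal.span (Set.range x) ≤ maximalIdeal R :=
    Ideal.span_le.2 (Set.range_subset_iff.2 hx)
  have hmin : maximalIdeal R ∈ (Ideal.span (Set.range x)).minimalPrimes := by
    refine ⟨⟨inferInstance, hle⟩, fun q ⟨hq, hxq⟩ _ ↦ ?_⟩
    exact hq.le_of_pow_le (n := 2) (hsq.trans_le (Ideal.mul_le_left.trans hxq))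
  have hheight := Ideal.height_le_card_of_mem_minimalPrimes_span (Set.finite_range x) hmin
  rw [← maximalIdeal_height_eq_ringKrullDim]
  have hcard : (Set.range x).ncard ≤ d := by
    simpa [Set.image_univ] using Set.ncard_image_le (f := x) Set.finite_univ
  exact_mod_cast hheight.trans (Nat.cast_le.2 hcard)

theorem RingTheory.Sequence.IsRegular.length_le_ringKrullDim {R : Type*} [CommRing R]
    [IsNoetherianRing R] [IsLocalRing R] {rs : List R} (h : IsRegular R rs) :
    (rs.length : WithBot ℕ∞) ≤ ringKrullDim R := by
  have hnontrivial : Nontrivial (R ⧸ Ideal.ofList rs) :=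
    Ideal.Quotient.nontrivial_iff.2 fun htop ↦ h.top_ne_smul (by simp [htop])
  rw [← ringKrullDim_add_length_eq_ringKrullDim_of_isRegular rs h]
  exact le_add_of_nonneg_left ringKrullDim_nonneg_of_nontrivial

theorem seqDepth_self_le_of_ringKrullDim_le {R : Type*} [CommRing R] [IsNoetherianRing R]
    [IsLocalRing R] {d : ℕ} (h : ringKrullDim R ≤ d) (I : Ideal R) : seqDepth R R I ≤ d := by
  refine sSup_le ?_
  rintro _ ⟨rs, rfl, -, hrs⟩
  exact_mod_cast hrs.length_le_ringKrullDim.trans h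

theorem exists_isSMulRegular_of_seqDepth_ne_zero {R M : Type*} [CommRing R] [AddCommGroup M]
    [Module R M] {I : Ideal R} (h : seqDepth R M I ≠ 0) : ∃ y ∈ I, IsSMulRegular M y := by
  contrapose! h
  refine sSup_eq_bot.2 ?_
  rintro _ ⟨rs, rfl, hmem, hrs⟩
  cases rs with
  | nil => rfl
  | cons y ys =>
    exact (h y (hmem y (by simp))
      ((RingTheory.Sequence.isWeaklyRegular_cons_iff M y ys).1 hrs.toIsWeaklyRegular).1).elim

namespace Polynomial

theorem isWeaklyRegular_X_C {R : Type*} [CommRing R] {y : R} (hy : IsSMulRegular R y) :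
    RingTheory.Sequence.IsWeaklyRegular R[X] [X, C y] := by
  rw [RingTheory.Sequence.isWeaklyRegular_cons_iff,
    RingTheory.Sequence.isWeaklyRegular_singleton_iff]
  refine ⟨monic_X.isRegular.left, ?_⟩
  rw [isSMulRegular_iff_right_eq_zero_of_smul]
  intro q hq
  obtain ⟨f, rfl⟩ := Submodule.Quotient.mk_surjective _ q
  rw [← Submodule.Quotient.mk_smul, Submodule.Quotient.mk_eq_zero,
    Submodule.mem_smul_pointwise_iff_exists] at hq
  obtain ⟨g, -, hg⟩ := hq
  have hcoeff : y • f.coeff 0 = y • 0 := by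
    simpa using (congrArg (coeff · 0) hg).symm
  obtain ⟨k, rfl⟩ := X_dvd_iff.2 (hy hcoeff)
  rw [Submodule.Quotient.mk_eq_zero, Submodule.mem_smul_pointwise_iff_exists]
  exact ⟨k, trivial, rfl⟩

theorem isMaximal_map_C_sup_span_X {R : Type*} [CommRing R] (m : Ideal R) [m.IsMaximal] :
    (m.map (C : R →+* R[X]) ⊔ Ideal.span {X}).IsMaximal := by
  have hcomap : m.comap (constantCoeff : R[X] →+* R) = m.map C ⊔ Ideal.span {X} := by
    apply le_antisymm
    · intro f hf
      rw [← X_mul_divX_add f, add_comm]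
      exact Submodule.add_mem_sup (Ideal.mem_map_of_mem C hf)
        (Ideal.mul_mem_right _ _ (Ideal.mem_span_singleton_self X))
    · rw [sup_le_iff, Ideal.map_le_iff_le_comap, Ideal.span_singleton_le_iff_mem]
      exact ⟨fun a ha ↦ by simpa using ha, by simp⟩
  rw [← hcomap]
  exact Ideal.comap_isMaximal_of_surjective _ constantCoeff_surjective

end Polynomial

theorem Ideal.sup_sq_eq_of_sq_eq {A : Type*} [CommRing A] {I J K : Ideal A}
    (h : I ^ 2 = J * I) (hJ : J ≤ I) : (I ⊔ K) ^ 2 = (J ⊔ K) * (I ⊔ K) := by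
  apply le_antisymm
  · rw [pow_two, Ideal.sup_mul, Ideal.mul_sup, ← pow_two, h]
    refine sup_le (sup_le (Ideal.mul_mono le_sup_left le_sup_left) ?_)
      (Ideal.mul_mono le_sup_right le_rfl)
    rw [mul_comm]
    exact Ideal.mul_mono le_sup_right le_sup_left
  · rw [pow_two]
    exact Ideal.mul_mono (sup_le_sup_right hJ K) le_rfl

theorem HasMinimalMultiplicity.of_isLocalization_polynomial {R : Type*} [CommRing R]
    [IsLocalRing R] {d : ℕ} (h : HasMinimalMultiplicity R d)
    [hP : ((maximalIdeal R).map (C : R →+* R[X]) ⊔ Ideal.span {X}).IsPrime]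
    (B : Type*) [CommRing B] [IsLocalRing B] [Algebra R[X] B]
    [IsLocalization.AtPrime B ((maximalIdeal R).map (C : R →+* R[X]) ⊔ Ideal.span {X})] :
    HasMinimalMultiplicity B (d + 1) := by
  obtain ⟨x, hx, hsq⟩ := h
  set P := (maximalIdeal R).map (C : R →+* R[X]) ⊔ Ideal.span {X}
  let z : Fin (d + 1) → R[X] := Fin.cons X fun i ↦ C (x i)
  have hspan : Ideal.span (Set.range z) =
      (Ideal.span (Set.range x)).map C ⊔ Ideal.span {X} := by
    rw [Fin.range_cons, Ideal.span_insert, Ideal.map_span, ← Set.range_comp, sup_comm]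
    rfl
  have hle : Ideal.span (Set.range x) ≤ maximalIdeal R :=
    Ideal.span_le.2 (Set.range_subset_iff.2 hx)
  have hz : Ideal.span (Set.range z) ≤ P :=
    hspan.trans_le (sup_le_sup_right (Ideal.map_mono hle) _)
  have hP2 : P ^ 2 = Ideal.span (Set.range z) * P := by
    rw [hspan]
    refine Ideal.sup_sq_eq_of_sq_eq ?_ (Ideal.map_mono hle)
    rw [← Ideal.map_pow, hsq, Ideal.map_mul]
  have hmax : P.map (algebraMap R[X] B) = maximalIdeal B :=
    IsLocalization.AtPrime.map_eq_maximalIdeal P B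
  refine ⟨algebraMap R[X] B ∘ z, fun i ↦ ?_, ?_⟩
  · rw [← hmax]
    exact Ideal.mem_map_of_mem _ (hz (Ideal.subset_span ⟨i, rfl⟩))
  · rw [← hmax, ← Ideal.map_pow, hP2, Ideal.map_mul, Ideal.map_span, ← Set.range_comp]

theorem exists_isRegular_of_isLocalization_polynomial {R : Type*} [CommRing R]
    [IsLocalRing R] {y : R} (hym : y ∈ maximalIdeal R) (hy : IsSMulRegular R y)
    [hP : ((maximalIdeal R).map (C : R →+* R[X]) ⊔ Ideal.span {X}).IsPrime]
    (B : Type*) [CommRing B] [IsLocalRing B] [Algebra R[X] B]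
    [IsLocalization.AtPrime B ((maximalIdeal R).map (C : R →+* R[X]) ⊔ Ideal.span {X})] :
    ∃ rs : List B, rs.length = 2 ∧ (∀ b ∈ rs, b ∈ maximalIdeal B) ∧
      RingTheory.Sequence.IsRegular B rs := by
  set P := (maximalIdeal R).map (C : R →+* R[X]) ⊔ Ideal.span {X}
  have hmem : ∀ b ∈ ([X, C y] : List R[X]).map (algebraMap R[X] B), b ∈ maximalIdeal B := by
    rw [← IsLocalization.AtPrime.map_eq_maximalIdeal P B]
    simp only [List.forall_mem_map, List.forall_mem_cons]
    exact ⟨Ideal.mem_map_of_mem _ (le_sup_right (a := (maximalIdeal R).map C)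
        (Ideal.mem_span_singleton_self X)),
      Ideal.mem_map_of_mem _ (le_sup_left (b := Ideal.span {X}) (Ideal.mem_map_of_mem C hym)),
      by simp⟩
  refine ⟨_, by simp, hmem, ?_⟩
  exact (isRegular_iff_isWeaklyRegular_of_subset_maximalIdeal hmem).2
    ((isWeaklyRegular_X_C hy).of_isLocalization B P.primeCompl)

/-- Let `(R,𝔪)` be a one-dimensional Cohen–Macaulay Noetherian local ring with minimal
multiplicity.  Then `B = R[X]_{(𝔪,X)}` is a two-dimensional Cohen–Macaulay Noetherian local
ring with minimal multiplicity.  (Here `(𝔪,X)` is the maximal ideal of `R[X]` generated by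
`𝔪` and `X`, and `B` is the localization of `R[X]` at it.) -/
theorem polynomial_localization_has_minimal_multiplicity
    (R : Type*) [CommRing R] [IsNoetherianRing R] [IsLocalRing R]
    (hdimR : ringKrullDim R = 1)
    (hdepthR : seqDepth R R (maximalIdeal R) = 1)
    (hminmult : HasMinimalMultiplicity R 1) :
    ∃ hmax : (Ideal.map (C : R →+* R[X]) (maximalIdeal R) ⊔
        Ideal.span {(X : R[X])}).IsMaximal,
      ∃ _ : IsLocalRing (Localization (@Ideal.primeCompl _ _
          (Ideal.map (C : R →+* R[X]) (maximalIdeal R) ⊔ Ideal.span {(X : R[X])})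
          hmax.isPrime)),
        IsNoetherianRing (Localization (@Ideal.primeCompl _ _
          (Ideal.map (C : R →+* R[X]) (maximalIdeal R) ⊔ Ideal.span {(X : R[X])})
          hmax.isPrime)) ∧
        ringKrullDim (Localization (@Ideal.primeCompl _ _
          (Ideal.map (C : R →+* R[X]) (maximalIdeal R) ⊔ Ideal.span {(X : R[X])})
          hmax.isPrime)) = 2 ∧
        seqDepth (Localization (@Ideal.primeCompl _ _
          (Ideal.map (C : R →+* R[X]) (maximalIdeal R) ⊔ Ideal.span {(X : R[X])})
          hmax.isPrime))
          (Localization (@Ideal.primeCompl _ _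
          (Ideal.map (C : R →+* R[X]) (maximalIdeal R) ⊔ Ideal.span {(X : R[X])})
          hmax.isPrime))
          (maximalIdeal _) = 2 ∧
        HasMinimalMultiplicity (Localization (@Ideal.primeCompl _ _
          (Ideal.map (C : R →+* R[X]) (maximalIdeal R) ⊔ Ideal.span {(X : R[X])})
          hmax.isPrime)) 2 := by
  have hmax := isMaximal_map_C_sup_span_X (maximalIdeal R)
  have := hmax.isPrime
  refine ⟨hmax, Localization.AtPrime.isLocalRing _, ?_⟩
  generalize_proofs
  set P := (maximalIdeal R).map (C : R →+* R[X]) ⊔ Ideal.span {X}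
  set B := Localization P.primeCompl
  have hnoeth : IsNoetherianRing B := IsLocalization.isNoetherianRing P.primeCompl B inferInstance
  have hmult : HasMinimalMultiplicity B 2 := hminmult.of_isLocalization_polynomial B
  obtain ⟨y, hym, hy⟩ := exists_isSMulRegular_of_seqDepth_ne_zero (M := R)
    (hdepthR.trans_ne one_ne_zero)
  obtain ⟨rs, hlen, hmem, hreg⟩ := exists_isRegular_of_isLocalization_polynomial hym hy B
  have hdim : ringKrullDim B ≤ (2 : ℕ) := hmult.ringKrullDim_le
  refine ⟨hnoeth, le_antisymm hdim ?_, le_antisymm ?_ ?_, hmult⟩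
  · simpa [hlen] using hreg.length_le_ringKrullDim
  · exact seqDepth_self_le_of_ringKrullDim_le hdim _
  · exact le_sSup ⟨rs, by simp [hlen], hmem, hreg⟩
end

section
/- Let (A,m) be a Cohen–Macaulay Noetherian local ring of dimension d ≥ 1 and let M be a finitely generated A-module which is not free. Then the function n ↦ length_A(Tor₁^A(M, A/m^{n+1})) agrees, for all sufficiently large n, with a polynomial in n of degree exactly d − 1. -/
open CategoryTheory IsLocalRing

/-- The length of a module, i.e. the Krull dimension of its lattice of submodules. -/
noncomputable def moduleLength (R : Type*) (M : Type*) [CommRing R] [AddCommGroup M]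
    [Module R M] : WithBot ℕ∞ :=
  Order.krullDim (Submodule R M)

/-- `length_A (Tor₁^A(M, A/𝔪^{n+1}))`. -/
noncomputable def torOneLength (A : Type) [CommRing A] [IsLocalRing A]
    (M : Type) [AddCommGroup M] [Module A M] (n : ℕ) : WithBot ℕ∞ :=
  moduleLength A (((Tor (ModuleCat A) 1).obj (ModuleCat.of A M)).obj
    (ModuleCat.of A (A ⧸ ((maximalIdeal A) ^ (n + 1)))))

section HilbertSamuelPolynomials

open Polynomial Filter

theorem exists_polynomial_forward_difference_eq (q : ℚ[X]) :
    ∃ P : ℚ[X], (∀ k : ℕ, q.degree < k → P.degree < (k + 1 : ℕ)) ∧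
      ∀ x : ℚ, P.eval (x + 1) - P.eval x = q.eval x := by
  refine ⟨∑ i ∈ q.support, C (q.coeff i / (i + 1)) * Polynomial.bernoulli (i + 1), ?_, ?_⟩
  · intro k hk
    rw [← mem_degreeLT]
    refine Submodule.sum_mem _ fun i hi => ?_
    rw [mem_degreeLT]
    have hik : i < k := by
      have := (le_degree_of_mem_supp i hi).trans_lt hk
      exact_mod_cast this
    refine (degree_mul_le _ _).trans_lt ?_
    refine lt_of_le_of_lt (add_le_add degree_C_le ?_) (b := (0 : WithBot ℕ) + (i + 1 : ℕ)) ?_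
    · unfold Polynomial.bernoulli
      refine (degree_sum_le _ _).trans (Finset.sup_le fun j hj => ?_)
      refine (degree_monomial_le _ _).trans ?_
      exact_mod_cast Nat.sub_le _ _
    · rw [zero_add]; exact_mod_cast Nat.succ_lt_succ hik
  · intro x
    rw [eval_finsetSum, eval_finsetSum, ← Finset.sum_sub_distrib, eval_eq_sum, Polynomial.sum]
    refine Finset.sum_congr rfl fun i _ => ?_
    rw [eval_mul, eval_mul, add_comm x 1, bernoulli_eval_one_add, eval_C, eval_C]
    have : (i : ℚ) + 1 ≠ 0 := by positivity
    obtain ⟨a, ha⟩ : ∃ a, q.coeff i = a * ((i : ℚ) + 1) := ⟨_, (div_mul_cancel₀ _ this).symm⟩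
    rw [ha, mul_div_cancel_right₀ _ this, Nat.add_sub_cancel]
    push_cast
    ring

theorem exists_polynomial_of_eventually_forward_difference {h : ℕ → ℚ} {q : ℚ[X]} {k : ℕ}
    (hq : q.degree < k) (hh : ∀ᶠ n in atTop, h (n + 1) - h n = q.eval (n : ℚ)) :
    ∃ p : ℚ[X], p.degree < (k + 1 : ℕ) ∧ ∀ᶠ n in atTop, h n = p.eval (n : ℚ) := by
  obtain ⟨P, hP, hP'⟩ := exists_polynomial_forward_difference_eq q
  obtain ⟨n₀, hn₀⟩ := eventually_atTop.mp hh
  refine ⟨P + C (h n₀ - P.eval (n₀ : ℚ)), ?_, eventually_atTop.mpr ⟨n₀, fun n hn => ?_⟩⟩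
  · refine (degree_add_le _ _).trans_lt (max_lt (hP k hq) (degree_C_le.trans_lt ?_))
    exact_mod_cast Nat.succ_pos k
  · induction n, hn using Nat.le_induction with
    | base => simp
    | succ n hn ih =>
      have h1 := hn₀ n hn
      have h2 := hP' n
      simp only [eval_add, eval_C] at ih ⊢
      push_cast
      linarith

theorem Polynomial.eq_of_eventually_eval_natCast_eq {p q : ℚ[X]}
    (h : ∀ᶠ n : ℕ in atTop, p.eval (n : ℚ) = q.eval (n : ℚ)) : p = q := by
  obtain ⟨n₀, hn₀⟩ := eventually_atTop.mp h
  refine eq_of_infinite_eval_eq p q ?_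
  refine Set.Infinite.mono (s := (fun n : ℕ => (n : ℚ)) '' Set.Ici n₀) ?_ ?_
  · rintro _ ⟨n, hn, rfl⟩; exact hn₀ n hn
  · exact (Set.Ici_infinite n₀).image Nat.cast_injective.injOn

theorem Polynomial.degree_le_of_eventually_eval_natCast_le {p q : ℚ[X]}
    (h : ∀ᶠ n : ℕ in atTop, 0 ≤ p.eval (n : ℚ) ∧ p.eval (n : ℚ) ≤ q.eval (n : ℚ)) :
    p.degree ≤ q.degree := by
  by_contra! hlt
  have hp : p ≠ 0 := by rintro rfl; simp at hlt
  rcases (zero_le_degree_iff.mpr hp).eq_or_lt with h0 | h0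
  · rw [← h0, ← not_le, zero_le_degree_iff, not_not] at hlt
    subst hlt
    apply hp
    refine eq_of_eventually_eval_natCast_eq (h.mono fun n hn => ?_)
    simpa using le_antisymm hn.2 (by simpa using hn.1)
  · have hlc : 0 ≤ p.leadingCoeff := by
      by_contra! hneg
      have h1 := (p.tendsto_atBot_of_leadingCoeff_nonpos h0 hneg.le).comp
        (tendsto_natCast_atTop_atTop (R := ℚ))
      obtain ⟨n, hn, hn'⟩ := ((h1.eventually (eventually_lt_atBot 0)).and h).exists
      exact absurd hn'.1 (not_le.mpr hn)
    have hpos := lt_of_le_of_ne hlc (leadingCoeff_ne_zero.mpr hp).symm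
    have h1 : 0 < (p - q).degree := by rwa [degree_sub_eq_left_of_degree_lt hlt]
    have h2 : 0 ≤ (p - q).leadingCoeff := by rwa [leadingCoeff_sub_of_degree_lt hlt]
    have h3 := ((p - q).tendsto_atTop_of_leadingCoeff_nonneg h1 h2).comp
        (tendsto_natCast_atTop_atTop (R := ℚ))
    obtain ⟨n, hn, hn'⟩ := ((h3.eventually (eventually_gt_atTop 0)).and h).exists
    simp only [Function.comp, eval_sub] at hn
    linarith [hn'.2]

theorem Polynomial.degree_sub_taylor_lt {p : ℚ[X]} (hp : p ≠ 0) (c : ℚ) :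
    (p - taylor c p).degree < p.degree :=
  degree_sub_lt_left (degree_taylor p c).symm hp (leadingCoeff_taylor c p).symm

theorem Polynomial.natCast_le_degree_taylor_sub {g : ℚ[X]} {k : ℕ} (h : (k + 1 : ℕ) ≤ g.degree) :
    (k : ℕ) ≤ (taylor 1 g - g).degree := by
  by_contra! hlt
  obtain ⟨q, hq, hq'⟩ := exists_polynomial_of_eventually_forward_difference
    (h := fun n : ℕ => g.eval (n : ℚ)) hlt (Eventually.of_forall fun n => by
      simp [taylor_eval])
  rw [eq_of_eventually_eval_natCast_eq hq'] at h
  exact absurd h (not_le.mpr hq)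

/-- `f` agrees for large arguments with the polynomial `p`; in particular it is finite there. -/
def EventuallyEval (f : ℕ → ℕ∞) (p : ℚ[X]) : Prop :=
  ∀ᶠ n in atTop, ∃ k : ℕ, f n = k ∧ (k : ℚ) = p.eval (n : ℚ)

theorem EventuallyEval.degree_le {f g : ℕ → ℕ∞} {p q : ℚ[X]} (hf : EventuallyEval f p)
    (hg : EventuallyEval g q) (h : ∀ᶠ n in atTop, f n ≤ g n) : p.degree ≤ q.degree := by
  refine degree_le_of_eventually_eval_natCast_le ?_
  filter_upwards [hf, hg, h] with n ⟨k, hk, hkp⟩ ⟨l, hl, hlq⟩ hle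
  rw [hk, hl] at hle
  rw [← hkp, ← hlq]
  exact ⟨by positivity, by exact_mod_cast hle⟩

theorem EventuallyEval.add {f g : ℕ → ℕ∞} {p q : ℚ[X]} (hf : EventuallyEval f p)
    (hg : EventuallyEval g q) : EventuallyEval (fun n => f n + g n) (p + q) := by
  filter_upwards [hf, hg] with n ⟨k, hk, hkp⟩ ⟨l, hl, hlq⟩
  exact ⟨k + l, by simp [hk, hl], by simp [hkp, hlq]⟩

theorem EventuallyEval.of_add_eq {f g h : ℕ → ℕ∞} {p q : ℚ[X]} (hf : EventuallyEval f p)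
    (hg : EventuallyEval g q) (hh : ∀ᶠ n in atTop, h n + g n = f n) :
    EventuallyEval h (p - q) := by
  filter_upwards [hf, hg, hh] with n ⟨k, hk, hkp⟩ ⟨l, hl, hlq⟩ hn
  rw [hk, hl] at hn
  have hfin : h n ≠ ⊤ := by rintro h; simp [h] at hn
  obtain ⟨m, hm⟩ := ENat.ne_top_iff_exists.mp hfin
  refine ⟨m, hm.symm, ?_⟩
  rw [← hm] at hn
  have : m + l = k := by exact_mod_cast hn
  rw [eval_sub, ← hkp, ← hlq, ← this]; push_cast; ring

theorem EventuallyEval.shift {f : ℕ → ℕ∞} {p : ℚ[X]} (hf : EventuallyEval f p) (c : ℕ) :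
    EventuallyEval (fun n => f (n + c)) (taylor (c : ℚ) p) := by
  filter_upwards [(tendsto_add_atTop_nat c).eventually hf] with n ⟨k, hk, hkp⟩
  exact ⟨k, hk, by rw [hkp, taylor_eval]; push_cast; ring_nf⟩

theorem EventuallyEval.shift_sub {f : ℕ → ℕ∞} {p : ℚ[X]} (hf : EventuallyEval f p) (c : ℕ) :
    EventuallyEval (fun n => f (n - c)) (taylor (-c : ℚ) p) := by
  filter_upwards [(tendsto_sub_atTop_nat c).eventually hf, eventually_ge_atTop c]
    with n ⟨k, hk, hkp⟩ hn
  exact ⟨k, hk, by rw [hkp, taylor_eval]; push_cast [hn]; ring_nf⟩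

theorem EventuallyEval.degree_le_of_add_le {f g h : ℕ → ℕ∞} {p q r : ℚ[X]}
    (hf : EventuallyEval f p) (hg : EventuallyEval g q) (hh : EventuallyEval h r)
    (hle : ∀ᶠ n in atTop, f n + g n ≤ h n) : p.degree ≤ (r - q).degree := by
  refine degree_le_of_eventually_eval_natCast_le ?_
  filter_upwards [hf, hg, hh, hle] with n ⟨k, hk, hkp⟩ ⟨l, hl, hlq⟩ ⟨m, hm, hmr⟩ hn
  rw [hk, hl, hm] at hn
  rw [eval_sub, ← hkp, ← hlq, ← hmr]
  have : k + l ≤ m := by exact_mod_cast hn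
  have : (k + l : ℚ) ≤ m := by exact_mod_cast this
  exact ⟨by positivity, by linarith⟩

theorem EventuallyEval.degree_le_of_le_add {f g h : ℕ → ℕ∞} {p q r : ℚ[X]}
    (hf : EventuallyEval f p) (hg : EventuallyEval g q) (hh : EventuallyEval h r)
    (hgh : ∀ᶠ n in atTop, g n ≤ h n) (hle : ∀ᶠ n in atTop, h n ≤ f n + g n) :
    (r - q).degree ≤ p.degree := by
  refine degree_le_of_eventually_eval_natCast_le ?_
  filter_upwards [hf, hg, hh, hgh, hle] with n ⟨k, hk, hkp⟩ ⟨l, hl, hlq⟩ ⟨m, hm, hmr⟩ hn' hn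
  rw [hl, hm] at hn'
  rw [hk, hl, hm] at hn
  rw [eval_sub, ← hkp, ← hlq, ← hmr]
  have h1 : m ≤ k + l := by exact_mod_cast hn
  have h2 : l ≤ m := by exact_mod_cast hn'
  have h1 : (m : ℚ) ≤ k + l := by exact_mod_cast h1
  have h2 : (l : ℚ) ≤ m := by exact_mod_cast h2
  constructor <;> linarith

section Colength

variable {R N : Type*} [CommRing R] [AddCommGroup N] [Module R N]

theorem Submodule.length_quotient_eq_add_of_le {P Q : Submodule R N} (h : Q ≤ P) :
    Module.length R (N ⧸ Q) =
      Module.length R (P ⧸ Q.comap P.subtype) + Module.length R (N ⧸ P) := by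
  refine Module.length_eq_add_of_exact (Submodule.mapQ _ Q P.subtype le_rfl)
    (Submodule.factor h) ?_ (Submodule.factor_surjective h) ?_
  · rw [← LinearMap.ker_eq_bot, Submodule.ker_mapQ]
    exact Submodule.mkQ_map_self _
  · rw [LinearMap.exact_iff, Submodule.range_mapQ, Submodule.range_subtype]
    ext x
    obtain ⟨x, rfl⟩ := Q.mkQ_surjective x
    simp only [LinearMap.mem_ker, Submodule.mkQ_apply, Submodule.mem_map]
    refine ⟨fun hx => ⟨x, (Submodule.Quotient.mk_eq_zero P).mp hx, rfl⟩, ?_⟩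
    rintro ⟨y, hy, hyx⟩
    refine (Submodule.Quotient.mk_eq_zero P).mpr ?_
    simpa using sub_mem hy (h ((Submodule.Quotient.eq _).mp hyx))

theorem Submodule.length_quotient_le_of_le {P Q : Submodule R N} (h : Q ≤ P) :
    Module.length R (N ⧸ P) ≤ Module.length R (N ⧸ Q) :=
  Module.length_le_of_surjective _ (Submodule.factor_surjective h)

/-- For an endomorphism `f`, the quotient of `P` by the preimage of `Q` is the
quotient of `f(P) + Q` by `Q`. -/
theorem Submodule.length_quotient_inf_comap_add (f : N →ₗ[R] N) (P Q : Submodule R N) :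
    Module.length R (N ⧸ (P ⊓ Q.comap f)) + Module.length R (N ⧸ (Q ⊔ P.map f)) =
      Module.length R (N ⧸ Q) + Module.length R (N ⧸ P) := by
  rw [length_quotient_eq_add_of_le (inf_le_left : P ⊓ Q.comap f ≤ P),
    length_quotient_eq_add_of_le (le_sup_left : Q ≤ Q ⊔ P.map f)]
  have e : Module.length R (P ⧸ (P ⊓ Q.comap f).comap P.subtype) =
      Module.length R (↥(Q ⊔ P.map f) ⧸ Q.comap (Q ⊔ P.map f).subtype) := by
    let g : P →ₗ[R] ↥(Q ⊔ P.map f) := f.restrict fun x hx =>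
      Submodule.mem_sup_right (Submodule.mem_map_of_mem hx)
    let h := (Q.comap (Q ⊔ P.map f).subtype).mkQ ∘ₗ g
    have hk : LinearMap.ker h = (P ⊓ Q.comap f).comap P.subtype := by
      ext x
      simp [h, LinearMap.mem_ker, g, LinearMap.restrict_apply]
    have hs : Function.Surjective h := by
      intro y
      obtain ⟨⟨y, hy⟩, rfl⟩ := Submodule.mkQ_surjective _ y
      obtain ⟨q, hq, z, ⟨x, hx, rfl⟩, rfl⟩ := Submodule.mem_sup.mp hy
      refine ⟨⟨x, hx⟩, ?_⟩
      simp only [h, LinearMap.comp_apply, Submodule.mkQ_apply]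
      rw [Submodule.Quotient.eq]
      simpa [g] using hq
    rw [← hk]
    exact (h.quotKerEquivOfSurjective hs).length_eq
  rw [e]
  ac_rfl

end Colength

section HilbertSamuel

variable {R : Type*} [CommRing R] {N : Type*} [AddCommGroup N] [Module R N]

namespace Ideal.Filtration

variable {I : Ideal R}

/-- The kernel of multiplication by `x`, raising degree by one, on `P / Q`. -/
def mulKer (x : R) (P Q : I.Filtration N) : I.Filtration N where
  N n := P.N n ⊓ (Q.N (n + 1)).comap (LinearMap.lsmul R N x)
  mono n := inf_le_inf (P.mono n) (Submodule.comap_mono (Q.mono _))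
  smul_le n := by
    refine le_inf ((smul_mono_right _ inf_le_left).trans (P.smul_le n)) ?_
    rw [Submodule.smul_le]
    rintro a ha y ⟨-, hy⟩
    refine Q.smul_le _ ?_
    have : LinearMap.lsmul R N x (a • y) = a • LinearMap.lsmul R N x y := map_smul _ _ _
    rw [this]
    exact Submodule.smul_mem_smul ha hy

/-- The preimage in `P` of the image of multiplication by `x`, raising degree by one, on
`P / Q`. -/
def mulRange (x : R) (P Q : I.Filtration N) : I.Filtration N where
  N n := Q.N n ⊔ (P.N (n - 1)).map (LinearMap.lsmul R N x)
  mono n := sup_le_sup (Q.mono n) (Submodule.map_mono (P.antitone (by lia)))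
  smul_le n := by
    rw [Submodule.smul_sup, ← Submodule.map_smul'']
    refine sup_le_sup (Q.smul_le n) (Submodule.map_mono ?_)
    cases n with
    | zero => exact Submodule.smul_le_right
    | succ n => exact P.smul_le n

/-- **Hilbert–Serre** for the graded quotient of two filtrations by submodules of finite
colength, when all but `t.card` of the generators of `I` annihilate it. -/
theorem exists_polynomial_length_sub [IsNoetherianRing R] [Module.Finite R N] (t : Finset R)
    (hts : (t : Set R) ⊆ I) : ∀ (J : Ideal R), I ≤ span t ⊔ J → ∀ (P Q : I.Filtration N),
    P.Stable → Q ≤ P → (∀ n, Module.length R (N ⧸ Q.N n) ≠ ⊤) →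
    (∀ n, J • P.N n ≤ Q.N (n + 1)) →
    ∃ p : ℚ[X], p.degree < t.card ∧ ∀ᶠ n in atTop,
      ((Module.length R (N ⧸ Q.N n)).toNat : ℚ) - (Module.length R (N ⧸ P.N n)).toNat =
        p.eval (n : ℚ) := by
  classical
  induction t using Finset.induction_on with
  | empty =>
    intro J hJ P Q ⟨n₀, hn₀⟩ hQP _ hJP
    refine ⟨0, by simp, eventually_atTop.mpr ⟨n₀ + 1, fun n hn => ?_⟩⟩
    obtain ⟨n, rfl⟩ : ∃ m, n = m + 1 := ⟨n - 1, by lia⟩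
    have hIJ : I ≤ J := by simpa using hJ
    have : P.N (n + 1) = Q.N (n + 1) := le_antisymm
      ((hn₀ n (by lia)).symm.le.trans ((Submodule.smul_mono_left hIJ).trans (hJP n))) (hQP _)
    rw [this, sub_self, eval_zero]
  | insert x t hx ih =>
    intro J hJ P Q hP hQP hfin hJP
    have hxI : x ∈ I := hts (by simp)
    have hJ' : I ≤ span t ⊔ (J ⊔ span {x}) := by
      refine hJ.trans ?_
      rw [Finset.coe_insert, Ideal.span_insert]
      exact sup_le (sup_le (le_sup_of_le_right le_sup_right) le_sup_left)
        (le_sup_of_le_right le_sup_left)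
    have hxP : ∀ n, ∀ y ∈ P.N n, x • y ∈ P.N (n + 1) := fun n y hy =>
      P.smul_le n (Submodule.smul_mem_smul hxI hy)
    have hQR : Q ≤ mulRange x P Q := fun n => le_sup_left
    have hPfin : ∀ n, Module.length R (N ⧸ P.N n) ≠ ⊤ := fun n =>
      ne_top_of_le_ne_top (hfin n) (Submodule.length_quotient_le_of_le (hQP n))
    have hts' := (Finset.coe_subset.mpr (Finset.subset_insert x t)).trans hts
    have hspan : ∀ (X Y : Submodule R N), (∀ y ∈ X, x • y ∈ Y) → span {x} • X ≤ Y := by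
      intro X Y h
      rw [Submodule.smul_le]
      intro r hr y hy
      obtain ⟨a, rfl⟩ := Ideal.mem_span_singleton'.mp hr
      rw [mul_smul]
      exact Y.smul_mem _ (h y hy)
    obtain ⟨pK, hpK, hK⟩ := ih hts' (J ⊔ span {x}) hJ' (mulKer x P Q) Q
      (hP.of_le fun n => inf_le_left)
      (fun n y hy => ⟨hQP n hy, Q.smul_le n (Submodule.smul_mem_smul hxI hy)⟩) hfin (by
        intro n
        rw [Submodule.sup_smul]
        exact sup_le ((smul_mono_right _ inf_le_left).trans (hJP n))
          (hspan _ _ fun y hy => hy.2))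
    obtain ⟨pC, hpC, hC⟩ := ih hts' (J ⊔ span {x}) hJ' P (mulRange x P Q) hP
      (fun n => sup_le (hQP n) (by
        rintro _ ⟨y, hy, rfl⟩
        cases n with
        | zero => exact (P.N 0).smul_mem x hy
        | succ n => exact hxP n y hy))
      (fun n => ne_top_of_le_ne_top (hfin n) (Submodule.length_quotient_le_of_le (hQR n))) (by
        intro n
        rw [Submodule.sup_smul]
        exact sup_le ((hJP n).trans le_sup_left)
          (hspan _ _ fun y hy => Submodule.mem_sup_right ⟨y, hy, rfl⟩))
    rw [Finset.card_insert_of_notMem hx]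
    refine exists_polynomial_of_eventually_forward_difference (q := taylor 1 pC - pK)
      ((degree_sub_le _ _).trans_lt (max_lt ((degree_taylor _ _).trans_lt hpC) hpK)) ?_
    filter_upwards [(tendsto_add_atTop_nat 1).eventually hC, hK] with n hCn hKn
    rw [eval_sub, taylor_eval, ← hKn, show (n : ℚ) + 1 = ((n + 1 : ℕ) : ℚ) by push_cast; rfl,
      ← hCn]
    have key := Submodule.length_quotient_inf_comap_add (LinearMap.lsmul R N x) (P.N n)
      (Q.N (n + 1))
    change Module.length R (N ⧸ (mulKer x P Q).N n) +
      Module.length R (N ⧸ (mulRange x P Q).N (n + 1)) = _ at key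
    have h1 : Module.length R (N ⧸ (mulKer x P Q).N n) ≠ ⊤ :=
      ne_top_of_le_ne_top (WithTop.add_ne_top.mpr ⟨hfin (n + 1), hPfin n⟩) (key ▸ le_self_add)
    have h2 : Module.length R (N ⧸ (mulRange x P Q).N (n + 1)) ≠ ⊤ :=
      ne_top_of_le_ne_top (hfin _) (Submodule.length_quotient_le_of_le (hQR _))
    have := congrArg ENat.toNat key
    rw [ENat.toNat_add h1 h2, ENat.toNat_add (hfin _) (hPfin _)] at this
    have : ((_ : ℕ) : ℚ) = (_ : ℕ) := congrArg Nat.cast this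
    push_cast at this
    linarith

end Ideal.Filtration

/-- The Hilbert–Samuel function of `N` with respect to `I`. -/
noncomputable def hilbertSamuel (I : Ideal R) (N : Type*) [AddCommGroup N] [Module R N] (n : ℕ) :
    ℕ∞ :=
  Module.length R (N ⧸ (I ^ n • ⊤ : Submodule R N))

theorem exists_eventuallyEval_hilbertSamuel [IsNoetherianRing R] [Module.Finite R N]
    (t : Finset R) (hfin : ∀ n, hilbertSamuel (Ideal.span (t : Set R)) N n ≠ ⊤) :
    ∃ p : ℚ[X], p.degree < (t.card + 1 : ℕ) ∧
      EventuallyEval (hilbertSamuel (Ideal.span (t : Set R)) N) p := by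
  set I := Ideal.span (t : Set R)
  let P := I.stableFiltration (⊤ : Submodule R N)
  let Q : I.Filtration N :=
    ⟨fun n => P.N (n + 1), fun n => P.mono _, fun n => P.smul_le _⟩
  obtain ⟨q, hq, h⟩ := Ideal.Filtration.exists_polynomial_length_sub t Ideal.subset_span ⊥
    (by simp) P Q (I.stableFiltration_stable ⊤) P.mono (fun n => hfin (n + 1)) (by simp)
  obtain ⟨p, hp, h'⟩ := exists_polynomial_of_eventually_forward_difference
    (h := fun n => ((hilbertSamuel I N n).toNat : ℚ)) hq h
  refine ⟨p, hp, h'.mono fun n hn => ⟨_, (ENat.natCast_toNat (hfin n)).symm, hn⟩⟩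

end HilbertSamuel

section LocalRing

open scoped Pointwise

open RingTheory.Sequence

section

variable {R : Type*} [CommRing R] {N : Type*} [AddCommGroup N] [Module R N]

theorem hilbertSamuel_le_of_surjective (I : Ideal R) {N' : Type*} [AddCommGroup N'] [Module R N']
    (g : N →ₗ[R] N') (hg : Function.Surjective g) (n : ℕ) :
    hilbertSamuel I N' n ≤ hilbertSamuel I N n := by
  refine Module.length_le_of_surjective (Submodule.mapQ _ _ g ?_) ?_
  · rw [← Submodule.map_le_iff_le_comap, Submodule.map_smul'']
    exact smul_mono_right _ le_top
  · intro y
    obtain ⟨y, rfl⟩ := Submodule.mkQ_surjective _ y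
    obtain ⟨x, rfl⟩ := hg y
    exact ⟨Submodule.Quotient.mk x, rfl⟩

theorem hilbertSamuel_le_of_le {I J : Ideal R} (h : I ≤ J) (n : ℕ) :
    hilbertSamuel J N n ≤ hilbertSamuel I N n :=
  Submodule.length_quotient_le_of_le (Submodule.smul_mono_left (Ideal.pow_right_mono h n))

variable [IsNoetherianRing R] [Module.Finite R N]

theorem exists_hilbertSamuel_quotSMulTop_add_le (I : Ideal R) {x : R} (hx : IsSMulRegular N x) :
    ∃ c, ∀ n ≥ c, hilbertSamuel I (QuotSMulTop x N) n + hilbertSamuel I N (n - c) ≤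
      hilbertSamuel I N n := by
  let f := LinearMap.lsmul R N x
  obtain ⟨c, hc⟩ := I.exists_pow_inf_eq_pow_smul (LinearMap.range f)
  refine ⟨c, fun n hn => ?_⟩
  have key := Submodule.length_quotient_inf_comap_add f ⊤ (I ^ n • ⊤)
  rw [Module.length_eq_zero (M := N ⧸ (⊤ : Submodule R N)), add_zero, add_comm] at key
  refine le_of_le_of_eq (add_le_add ?_ ?_) key
  · refine Module.length_le_of_surjective (Submodule.mapQ _ _ (Submodule.mkQ _) ?_) ?_
    · rw [sup_le_iff, ← Submodule.map_le_iff_le_comap, ← Submodule.map_le_iff_le_comap,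
        Submodule.map_smul'']
      refine ⟨smul_mono_right _ le_top, ?_⟩
      rw [← Submodule.map_comp]
      rintro _ ⟨y, -, rfl⟩
      convert Submodule.zero_mem _
      exact (Submodule.Quotient.mk_eq_zero _).mpr (Submodule.smul_mem_pointwise_smul y x ⊤ trivial)
    · intro y
      obtain ⟨y, rfl⟩ := Submodule.mkQ_surjective _ y
      obtain ⟨y, rfl⟩ := Submodule.mkQ_surjective _ y
      exact ⟨Submodule.Quotient.mk y, rfl⟩
  · refine Submodule.length_quotient_le_of_le ?_
    rintro y ⟨-, hy⟩
    have h1 : f y ∈ I ^ n • ⊤ ⊓ LinearMap.range f := ⟨hy, y, rfl⟩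
    rw [hc n hn] at h1
    have h2 : I ^ (n - c) • (I ^ c • ⊤ ⊓ LinearMap.range f) ≤ I ^ (n - c) • LinearMap.range f :=
      smul_mono_right _ inf_le_right
    replace h2 := h2 h1
    rw [LinearMap.range_eq_map, ← Submodule.map_smul''] at h2
    obtain ⟨z, hz, hzy⟩ := h2
    exact hx hzy ▸ hz

variable [IsLocalRing R]

theorem IsLocalRing.isArtinianRing_quotient_of_maximalIdeal_pow_le {J : Ideal R} {k : ℕ}
    (h : maximalIdeal R ^ k ≤ J) : IsArtinianRing (R ⧸ J) := by
  rcases eq_or_ne J ⊤ with rfl | hJ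
  · have : Subsingleton (R ⧸ (⊤ : Ideal R)) := Ideal.Quotient.subsingleton_iff.mpr rfl
    exact inferInstance
  · refine quotient_artinian_of_mem_minimalPrimes_of_isLocalRing J
      ⟨⟨inferInstance, le_maximalIdeal hJ⟩, fun q hq _ => ?_⟩
    have := hq.1
    exact Ideal.IsPrime.le_of_pow_le (h.trans hq.2)

theorem hilbertSamuel_ne_top {I : Ideal R} {k : ℕ} (h : maximalIdeal R ^ k ≤ I) (n : ℕ) :
    hilbertSamuel I N n ≠ ⊤ := by
  have hn : maximalIdeal R ^ (k * n) ≤ I ^ n := by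
    rw [pow_mul]; exact Ideal.pow_right_mono h n
  have := isArtinianRing_quotient_of_maximalIdeal_pow_le hn
  unfold hilbertSamuel
  rw [Module.length_eq_of_surjective (S := R) (R := R ⧸ I ^ n) Ideal.Quotient.mk_surjective]
  exact Module.length_ne_top

theorem exists_eventuallyEval_hilbertSamuel_maximalIdeal {d : ℕ} (hd : ringKrullDim R = d) :
    ∃ p : ℚ[X], p.degree < (d + 1 : ℕ) ∧ EventuallyEval (hilbertSamuel (maximalIdeal R) N) p := by
  obtain ⟨s, hs⟩ := IsNoetherian.noetherian (maximalIdeal R)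
  obtain ⟨p, -, hp⟩ := exists_eventuallyEval_hilbertSamuel (N := N) s (by
    intro n
    change hilbertSamuel (Submodule.span R (s : Set R)) N n ≠ ⊤
    rw [hs]
    exact hilbertSamuel_ne_top (k := 1) (by simp) n)
  change EventuallyEval (hilbertSamuel (Submodule.span R (s : Set R)) N) p at hp
  rw [hs] at hp
  refine ⟨p, ?_, hp⟩
  obtain ⟨t, ht, htc⟩ := (maximalIdeal R).exists_finset_card_eq_height_of_isNoetherianRing
  have htd : t.card = d := by
    have h1 := maximalIdeal_height_eq_ringKrullDim (R := R)
    rw [hd, ← htc] at h1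
    exact_mod_cast h1
  have := quotient_artinian_of_mem_minimalPrimes_of_isLocalRing _ ht
  obtain ⟨k, hk⟩ := exists_maximalIdeal_pow_le_of_isArtinianRing_quotient (Ideal.span (t : Set R))
  obtain ⟨q, hq, hq'⟩ := exists_eventuallyEval_hilbertSamuel (N := N) t (hilbertSamuel_ne_top hk)
  rw [← htd]
  exact (hp.degree_le hq' (Eventually.of_forall
    fun n => hilbertSamuel_le_of_le ht.1.2 n)).trans_lt hq

end

theorem IsSMulRegular.exists_comp_eq_of_ne_zero {R X N : Type*} [CommRing R] [IsNoetherianRing R]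
    [IsLocalRing R] [AddCommGroup X] [Module R X] [Module.Finite R X] [AddCommGroup N] [Module R N]
    {x : R} (hx : IsSMulRegular X x) (hxm : x ∈ maximalIdeal R) {f : N →ₗ[R] X} (hf : f ≠ 0) :
    ∃ g : N →ₗ[R] X, ¬ LinearMap.range g ≤ x • (⊤ : Submodule R X) := by
  by_contra! h
  have key : ∀ j : ℕ, ∃ g : N →ₗ[R] X, f = x ^ j • g := by
    intro j
    induction j with
    | zero => exact ⟨f, by simp⟩
    | succ j ih =>
      obtain ⟨g, rfl⟩ := ih
      let φ := LinearMap.lsmul R X x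
      have hg : ∀ v, g v ∈ LinearMap.range φ := by
        intro v
        obtain ⟨y, -, hy⟩ := h g ⟨v, rfl⟩
        exact ⟨y, hy⟩
      refine ⟨(LinearEquiv.ofInjective φ hx).symm.toLinearMap ∘ₗ g.codRestrict _ hg, ?_⟩
      ext v
      have := congrArg Subtype.val
        ((LinearEquiv.ofInjective φ hx).apply_symm_apply (g.codRestrict _ hg v))
      change φ _ = g v at this
      simp only [LinearMap.smul_apply, LinearMap.comp_apply, pow_succ, mul_smul,
        LinearEquiv.coe_coe]
      congr 1
      exact this.symm
  apply hf
  ext v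
  have : f v ∈ (⨅ i : ℕ, maximalIdeal R ^ i • ⊤ : Submodule R X) := by
    rw [Submodule.mem_iInf]
    intro i
    obtain ⟨g, hg⟩ := key i
    rw [hg]
    exact Submodule.smul_mem_smul (Ideal.pow_mem_pow hxm i) trivial
  rw [Ideal.iInf_pow_smul_eq_bot_of_isLocalRing _ (Ideal.IsPrime.ne_top inferInstance)] at this
  simpa using this

/-- A module with a nonzero map to a module `X` has dimension at least the depth of `X`. -/
theorem RingTheory.Sequence.IsWeaklyRegular.length_le_degree.{u, v} {R : Type u} [CommRing R]
    [IsNoetherianRing R] [IsLocalRing R] {d : ℕ} (hd : ringKrullDim R = d) (rs : List R) :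
    ∀ {X : Type v} [AddCommGroup X] [Module R X] [Module.Finite R X]
      {N : Type v} [AddCommGroup N] [Module R N] [Module.Finite R N]
      (_ : IsWeaklyRegular X rs) (_ : ∀ x ∈ rs, x ∈ maximalIdeal R)
      {f : N →ₗ[R] X} (_ : f ≠ 0) {p : ℚ[X]}
      (_ : EventuallyEval (hilbertSamuel (maximalIdeal R) N) p), (rs.length : ℕ) ≤ p.degree := by
  induction rs with
  | nil =>
    intro X _ _ _ N _ _ _ _ _ f hf p hp
    rw [List.length_nil, Nat.cast_zero, zero_le_degree_iff]
    rintro rfl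
    obtain ⟨n, ⟨k, hk, hk'⟩, hn⟩ := (hp.and (eventually_ge_atTop 1)).exists
    have hk0 : k = 0 := by simpa using hk'
    subst hk0
    have h1 : Subsingleton (N ⧸ (maximalIdeal R ^ n • ⊤ : Submodule R N)) :=
      Module.length_eq_zero_iff.mp (by simpa [hilbertSamuel] using hk)
    rw [Submodule.Quotient.subsingleton_iff] at h1
    have h2 : (⊤ : Submodule R N) = ⊥ := by
      refine Submodule.eq_bot_of_le_smul_of_le_jacobson_bot (maximalIdeal R) ⊤
        Module.Finite.fg_top ?_ (maximalIdeal_le_jacobson _)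
      exact h1.symm.le.trans (Submodule.smul_mono_left (Ideal.pow_le_self (by lia)))
    apply hf
    ext v
    have : v ∈ (⊤ : Submodule R N) := trivial
    rw [h2, Submodule.mem_bot] at this
    simp [this]
  | cons x rs ih =>
    intro X _ _ _ N _ _ _ hreg hmem f hf p hp
    rw [isWeaklyRegular_cons_iff] at hreg
    obtain ⟨g, hg⟩ := hreg.1.exists_comp_eq_of_ne_zero (hmem x (by simp)) hf
    let N' := LinearMap.range g
    have hN' : IsSMulRegular N' x := hreg.1.submodule N' x
    obtain ⟨q, -, hq⟩ := exists_eventuallyEval_hilbertSamuel_maximalIdeal (N := N') hd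
    obtain ⟨q', -, hq'⟩ := exists_eventuallyEval_hilbertSamuel_maximalIdeal
      (N := QuotSMulTop x N') hd
    have hg' : QuotSMulTop.map x N'.subtype ≠ 0 := by
      intro h0
      apply hg
      rintro y hy
      have := LinearMap.congr_fun h0 (Submodule.Quotient.mk ⟨y, hy⟩)
      exact (Submodule.Quotient.mk_eq_zero _).mp this
    have h1 : (rs.length : ℕ) ≤ q'.degree :=
      ih hreg.2 (fun y hy => hmem y (List.mem_cons_of_mem _ hy)) hg' hq'
    obtain ⟨c, hc⟩ := exists_hilbertSamuel_quotSMulTop_add_le (maximalIdeal R) hN'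
    have h2 : q'.degree ≤ (q - taylor (-(c : ℚ)) q).degree :=
      hq'.degree_le_of_add_le (hq.shift_sub c) hq (eventually_atTop.mpr ⟨c, hc⟩)
    have h3 : q ≠ 0 := by
      rintro rfl
      simp at h2
      simp [h2] at h1
    have h4 := (h1.trans h2).trans_lt (degree_sub_taylor_lt h3 _)
    refine le_trans ?_ (hq.degree_le hp (Eventually.of_forall fun n =>
      hilbertSamuel_le_of_surjective _ g.rangeRestrict g.surjective_rangeRestrict n))
    rw [degree_eq_natDegree h3] at h4 ⊢
    exact_mod_cast h4

end LocalRing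

section Syzygy

open RingTheory.Sequence

variable {R : Type*} [CommRing R] {F : Type*} [AddCommGroup F] [Module R F]
  {M : Type*} [AddCommGroup M] [Module R M]

theorem hilbertSamuel_eq_length_add_of_surjective (I : Ideal R) {π : F →ₗ[R] M}
    (hπ : Function.Surjective π) (n : ℕ) :
    hilbertSamuel I F n =
      Module.length R (LinearMap.ker π ⧸
        (I ^ n • ⊤ : Submodule R F).comap (LinearMap.ker π).subtype) + hilbertSamuel I M n := by
  have hmap : (I ^ n • ⊤ : Submodule R F).map π = I ^ n • ⊤ := by
    rw [Submodule.map_smul'', Submodule.map_top, LinearMap.range_eq_top.mpr hπ]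
  refine Module.length_eq_add_of_exact
    (Submodule.mapQ _ (I ^ n • ⊤ : Submodule R F) (LinearMap.ker π).subtype le_rfl)
    (Submodule.mapQ _ _ π (Submodule.map_le_iff_le_comap.mp hmap.le)) ?_ ?_ ?_
  · rw [← LinearMap.ker_eq_bot, Submodule.ker_mapQ]
    exact Submodule.mkQ_map_self _
  · intro y
    obtain ⟨y, rfl⟩ := Submodule.mkQ_surjective _ y
    obtain ⟨x, rfl⟩ := hπ y
    exact ⟨Submodule.Quotient.mk x, rfl⟩
  · rw [LinearMap.exact_iff, Submodule.range_mapQ, Submodule.range_subtype, Submodule.ker_mapQ,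
      ← hmap, Submodule.comap_map_eq, Submodule.map_sup, Submodule.mkQ_map_self, bot_sup_eq]

variable [IsLocalRing R] [Module.Finite R M]

theorem IsLocalRing.exists_surjective_ker_le_maximalIdeal_smul :
    ∃ (r : ℕ) (π : (Fin r → R) →ₗ[R] M), Function.Surjective π ∧
      LinearMap.ker π ≤ maximalIdeal R • ⊤ := by
  classical
  have hex : ∃ r : ℕ, ∃ π : (Fin r → R) →ₗ[R] M, Function.Surjective π :=
    Module.Finite.exists_fin' R M
  obtain ⟨π, hπ⟩ := Nat.find_spec hex
  refine ⟨_, π, hπ, fun y hy => ?_⟩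
  have key : ∀ i, y i ∈ maximalIdeal R := by
    intro i
    by_contra hi
    obtain ⟨s, hs⟩ : ∃ s, Nat.find hex = s + 1 := Nat.exists_eq_succ_of_ne_zero (by
      have := i.2; lia)
    refine Nat.find_min hex (m := s) (by lia) ?_
    revert i y π
    rw [hs]
    intro π hπ y hy i hi
    have hu : IsUnit (y i) := by simpa using hi
    obtain ⟨u, hu⟩ := hu
    refine ⟨π ∘ₗ LinearMap.pi fun j => if h : ∃ k, i.succAbove k = j then
      LinearMap.proj h.choose else 0, fun m => ?_⟩
    obtain ⟨x, rfl⟩ := hπ m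
    refine ⟨fun k => (x - (x i * ↑u⁻¹) • y) (i.succAbove k), ?_⟩
    have : π x = π (x - (x i * ↑u⁻¹) • y) := by
      rw [map_sub, map_smul, LinearMap.mem_ker.mp hy, smul_zero, sub_zero]
    rw [this, LinearMap.comp_apply]
    congr 1
    ext j
    rw [LinearMap.pi_apply]
    split_ifs with h
    · exact congrArg (x - (x i * ↑u⁻¹) • y) h.choose_spec
    · have hj : j = i := by
        by_contra hne
        exact h (Fin.exists_succAbove_eq hne)
      subst hj
      simp [← hu]
  rw [pi_eq_sum_univ' y]
  exact Submodule.sum_mem _ fun i _ => Submodule.smul_mem_smul (key i) trivial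

variable [IsNoetherianRing R] [Module.Finite R F]

/-- If `t` is related to the Hilbert-Samuel functions of a minimal presentation
of `M` in the same way as the lengths of `Tor₁(M, R ⧸ 𝔪 ^ (n + 1))`, then it is eventually a
polynomial of degree one less than the degree of the Hilbert-Samuel polynomial of the syzygy. -/
theorem exists_eventuallyEval_of_add_hilbertSamuel_eq {d : ℕ} (hd : ringKrullDim R = (d + 1 : ℕ))
    {π : F →ₗ[R] M} (hπ : Function.Surjective π)
    (hmin : LinearMap.ker π ≤ maximalIdeal R • ⊤)
    (hdeg : ∀ p, EventuallyEval (hilbertSamuel (maximalIdeal R) (LinearMap.ker π)) p →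
      (d + 1 : ℕ) ≤ p.degree)
    {t : ℕ → ℕ∞}
    (ht : ∀ n, t n + hilbertSamuel (maximalIdeal R) F (n + 1) =
      hilbertSamuel (maximalIdeal R) (LinearMap.ker π) (n + 1) +
        hilbertSamuel (maximalIdeal R) M (n + 1)) :
    ∃ p : ℚ[X], p.degree = d ∧ EventuallyEval t p := by
  set L := LinearMap.ker π
  set I := maximalIdeal R
  obtain ⟨g, hg, hgL⟩ := exists_eventuallyEval_hilbertSamuel_maximalIdeal (N := L) hd
  obtain ⟨gF, -, hgF⟩ := exists_eventuallyEval_hilbertSamuel_maximalIdeal (N := F) hd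
  obtain ⟨gM, -, hgM⟩ := exists_eventuallyEval_hilbertSamuel_maximalIdeal (N := M) hd
  have hL1 := hgL.shift 1
  obtain ⟨p, hp⟩ : ∃ p, EventuallyEval t p :=
    ⟨_, (hL1.add (hgM.shift 1)).of_add_eq (hgF.shift 1) (Eventually.of_forall ht)⟩
  have hsplit : ∀ n, t n + Module.length R (L ⧸ (I ^ (n + 1) • ⊤ : Submodule R F).comap L.subtype) =
      hilbertSamuel I L (n + 1) := by
    intro n
    have h := ht n
    rw [hilbertSamuel_eq_length_add_of_surjective I hπ, ← add_assoc] at h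
    have hfin := hilbertSamuel_ne_top (I := I) (N := M) (k := 1) (by simp [I]) (n + 1)
    exact (ENat.addLECancellable_of_ne_top hfin).inj_left.mp h
  have hdegL := hdeg g hgL
  have hg0 : g ≠ 0 := by rintro rfl; simp at hdegL
  have hdegL' : g.degree = (d + 1 : ℕ) := by
    rw [degree_eq_natDegree hg0] at hg hdegL ⊢
    norm_cast at *
    lia
  refine ⟨p, le_antisymm ?_ ?_, hp⟩
  · obtain ⟨c, hc⟩ := I.exists_pow_inf_eq_pow_smul L
    have h1 := hp.degree_le_of_add_le ((hgL.shift_sub c).shift 1) hL1 (by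
      filter_upwards [eventually_ge_atTop c] with n hn
      rw [← hsplit n]
      refine add_le_add le_rfl (Submodule.length_quotient_le_of_le fun y hy => ?_)
      have h1 : (y : F) ∈ I ^ (n + 1) • ⊤ ⊓ L := ⟨hy, y.2⟩
      rw [hc (n + 1) (by lia)] at h1
      have h2 : I ^ (n + 1 - c) • (I ^ c • ⊤ ⊓ L) ≤ I ^ (n + 1 - c) • L :=
        smul_mono_right _ inf_le_right
      have h3 : I ^ (n + 1 - c) • L = (I ^ (n + 1 - c) • ⊤ : Submodule R L).map L.subtype := by
        rw [Submodule.map_smul'', Submodule.map_top, Submodule.range_subtype]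
      replace h2 := h2 h1
      rw [h3] at h2
      obtain ⟨z, hz, hzy⟩ := h2
      rwa [← Subtype.ext hzy])
    rw [← map_sub, degree_taylor] at h1
    have h2 := h1.trans_lt (degree_sub_taylor_lt hg0 _)
    rw [hdegL'] at h2
    by_cases hp0 : p = 0
    · simp [hp0]
    rw [degree_eq_natDegree hp0] at h2 ⊢
    norm_cast at *
    lia
  · refine (natCast_le_degree_taylor_sub hdegL).trans ?_
    simp only [Nat.cast_one] at hL1
    refine hp.degree_le_of_le_add hgL hL1 (Eventually.of_forall fun n => ?_)
      (Eventually.of_forall fun n => ?_)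
    · exact Submodule.length_quotient_le_of_le
        (Submodule.smul_mono_left (Ideal.pow_le_pow_right n.le_succ))
    · rw [← hsplit n]
      refine add_le_add le_rfl (Submodule.length_quotient_le_of_le ?_)
      rw [← Submodule.map_le_iff_le_comap, Submodule.map_smul'', Submodule.map_top,
        Submodule.range_subtype, pow_succ, mul_smul]
      exact smul_mono_right _ hmin

theorem RingTheory.Sequence.IsWeaklyRegular.length_le_degree_of_submodule_pi {d : ℕ}
    (hd : ringKrullDim R = d) {rs : List R} (hrs : IsWeaklyRegular R rs)
    (hmem : ∀ x ∈ rs, x ∈ maximalIdeal R) {r : ℕ} {L : Submodule R (Fin r → R)} (hL : L ≠ ⊥)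
    {p : ℚ[X]} (hp : EventuallyEval (hilbertSamuel (maximalIdeal R) L) p) :
    (rs.length : ℕ) ≤ p.degree := by
  obtain ⟨y, hy, hy0⟩ := L.exists_mem_ne_zero_of_ne_bot hL
  obtain ⟨i, hi⟩ := Function.ne_iff.mp hy0
  refine hrs.length_le_degree hd rs hmem (f := LinearMap.proj i ∘ₗ L.subtype) (fun h => hi ?_) hp
  exact LinearMap.congr_fun h ⟨y, hy⟩

end Syzygy

end HilbertSamuelPolynomials

section Tor

open MonoidalCategory

universe u

variable {R : Type u} [CommRing R]

theorem Module.length_add_length_eq_of_exact {T L F M : Type*} [AddCommGroup T] [Module R T]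
    [AddCommGroup L] [Module R L] [AddCommGroup F] [Module R F] [AddCommGroup M] [Module R M]
    {i : T →ₗ[R] L} {a : L →ₗ[R] F} {b : F →ₗ[R] M} (hi : Function.Injective i)
    (hia : Function.Exact i a) (hab : Function.Exact a b) (hb : Function.Surjective b) :
    Module.length R T + Module.length R F = Module.length R L + Module.length R M := by
  have h1 : Module.length R L = Module.length R T + Module.length R (LinearMap.range a) :=
    Module.length_eq_add_of_exact i a.rangeRestrict hi a.surjective_rangeRestrict (by
      rw [LinearMap.exact_iff] at hia ⊢
      rw [LinearMap.ker_rangeRestrict, hia])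
  have h2 : Module.length R F = Module.length R (LinearMap.range a) + Module.length R M :=
    Module.length_eq_add_of_exact (LinearMap.range a).subtype b (Submodule.subtype_injective _) hb
      (by rw [LinearMap.exact_iff] at hab ⊢; rw [hab, Submodule.range_subtype])
  rw [h1, h2, add_assoc]

/-- The complex `X ⊗ K`, as a functor of `X`. -/
noncomputable def tensorComplex (K : ChainComplex (ModuleCat.{u} R) ℕ) :
    ModuleCat.{u} R ⥤ ChainComplex (ModuleCat.{u} R) ℕ where
  obj X := (((tensoringLeft _).obj X).mapHomologicalComplex _).obj K
  map f := (NatTrans.mapHomologicalComplex ((tensoringLeft _).map f) _).app K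

instance (K : ChainComplex (ModuleCat.{u} R) ℕ) : (tensorComplex K).PreservesZeroMorphisms where
  map_zero X Y := by
    ext i : 1
    exact MonoidalPreadditive.zero_whiskerRight

theorem tensorComplex_shortExact {K : ChainComplex (ModuleCat.{u} R) ℕ}
    [∀ i, Module.Flat R (K.X i)] {S : ShortComplex (ModuleCat.{u} R)} (hS : S.ShortExact) :
    (S.map (tensorComplex K)).ShortExact := by
  refine HomologicalComplex.shortExact_of_degreewise_shortExact _ fun i => ?_
  refine ModuleCat.shortComplex_shortExact _ ?_ ?_ ?_
  · exact Module.Flat.rTensor_exact (K.X i)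
      ((ShortComplex.ShortExact.moduleCat_exact_iff_function_exact S).mp hS.exact)
  · exact Module.Flat.rTensor_preserves_injective_linearMap _ hS.moduleCat_injective_f
  · exact LinearMap.rTensor_surjective _ hS.moduleCat_surjective_g

theorem tensorComplex_exactAt_succ {Y : ModuleCat.{u} R} (P : ProjectiveResolution Y)
    (F : ModuleCat.{u} R) [Module.Flat R F] (n : ℕ) :
    ((tensorComplex P.complex).obj F).ExactAt (n + 1) := by
  rw [HomologicalComplex.exactAt_iff' _ (n + 2) (n + 1) n (by simp only [ChainComplex.prev]; rfl)
    (by simp)]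
  exact ModuleCat.shortComplex_exact _ (Module.Flat.lTensor_exact F
    ((ShortComplex.ShortExact.moduleCat_exact_iff_function_exact _).mp (P.exact_succ n)))

theorem length_tor_one_add_length_tensor {S : ShortComplex (ModuleCat.{u} R)} (hS : S.ShortExact)
    [Module.Flat R S.X₂] (Y : ModuleCat.{u} R) :
    Module.length R (((Tor (ModuleCat.{u} R) 1).obj S.X₃).obj Y) +
        Module.length R (S.X₂ ⊗ Y : ModuleCat R) =
      Module.length R (S.X₁ ⊗ Y : ModuleCat R) + Module.length R (S.X₃ ⊗ Y : ModuleCat R) := by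
  let P := projectiveResolution Y
  have (i : ℕ) : Module.Flat R (P.complex.X i) := by
    have : Projective (ModuleCat.of R (P.complex.X i)) := P.projective i
    have := (IsProjective.iff_projective (R := R) (P.complex.X i)).mpr this
    infer_instance
  have hP := tensorComplex_shortExact (K := P.complex) hS
  have hzero (X : ModuleCat.{u} R) : Module.length R (X ⊗ Y : ModuleCat R) =
      Module.length R (((tensorComplex P.complex).obj X).homology 0) :=
    (((Functor.leftDerivedZeroIsoSelf ((tensoringLeft _).obj X)).app Y).symm ≪≫
      P.isoLeftDerivedObj ((tensoringLeft _).obj X) 0).toLinearEquiv.length_eq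
  have hone : Module.length R (((Tor (ModuleCat.{u} R) 1).obj S.X₃).obj Y) =
      Module.length R (((tensorComplex P.complex).obj S.X₃).homology 1) :=
    (P.isoLeftDerivedObj ((tensoringLeft _).obj S.X₃) 1).toLinearEquiv.length_eq
  rw [hone, hzero, hzero, hzero]
  have hrel : (ComplexShape.down ℕ).Rel 1 0 := by simp
  have hmono : Mono (hP.δ 1 0 hrel) :=
    hP.mono_δ 1 0 hrel (tensorComplex_exactAt_succ P S.X₂ 0).isZero_homology
  have hepi : Epi (HomologicalComplex.homologyMap (S.map (tensorComplex P.complex)).g 0) := by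
    have := hP.epi_g
    exact HomologicalComplex.epi_homologyMap_of_epi_of_not_rel _ _ (by simp)
  exact Module.length_add_length_eq_of_exact
    ((ModuleCat.mono_iff_injective _).mp hmono)
    ((ShortComplex.ShortExact.moduleCat_exact_iff_function_exact _).mp
      (hP.homology_exact₁ 1 0 hrel))
    ((ShortComplex.ShortExact.moduleCat_exact_iff_function_exact _).mp (hP.homology_exact₂ 0))
    ((ModuleCat.epi_iff_surjective _).mp hepi)

end Tor

section TorOneLength

theorem seqDepth.exists_isRegular {R M : Type*} [CommRing R] [AddCommGroup M] [Module R M]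
    {I : Ideal R} {d : ℕ} (h : seqDepth R M I = d) (hd : 1 ≤ d) :
    ∃ rs : List R, rs.length = d ∧ (∀ x ∈ rs, x ∈ I) ∧ RingTheory.Sequence.IsRegular M rs := by
  obtain ⟨e, rfl⟩ := Nat.exists_eq_add_of_le' hd
  have hlt : (e : ℕ∞) < seqDepth R M I := by rw [h]; exact_mod_cast e.lt_succ_self
  obtain ⟨_, ⟨rs, rfl, hmem, hreg⟩, hlen⟩ := lt_sSup_iff.mp hlt
  refine ⟨rs, le_antisymm ?_ (by exact_mod_cast hlen), hmem, hreg⟩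
  have : (rs.length : ℕ∞) ≤ seqDepth R M I := le_sSup ⟨rs, rfl, hmem, hreg⟩
  rw [h] at this
  exact_mod_cast this

theorem length_tensorObj_quotient_pow {A : Type} [CommRing A] [IsLocalRing A] (X : ModuleCat.{0} A)
    (n : ℕ) : Module.length A (MonoidalCategory.tensorObj X
        (ModuleCat.of A (A ⧸ (maximalIdeal A) ^ n)) : ModuleCat A) =
      hilbertSamuel (maximalIdeal A) X n :=
  (TensorProduct.tensorQuotEquivQuotSMul X ((maximalIdeal A) ^ n)).length_eq

theorem length_tor_one_add_hilbertSamuel {A : Type} [CommRing A] [IsLocalRing A]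
    {F M : Type} [AddCommGroup F] [Module A F] [AddCommGroup M] [Module A M] [Module.Flat A F]
    {π : F →ₗ[A] M} (hπ : Function.Surjective π) (n : ℕ) :
    Module.length A (((Tor (ModuleCat A) 1).obj (ModuleCat.of A M)).obj
        (ModuleCat.of A (A ⧸ (maximalIdeal A) ^ n))) + hilbertSamuel (maximalIdeal A) F n =
      hilbertSamuel (maximalIdeal A) (LinearMap.ker π) n + hilbertSamuel (maximalIdeal A) M n := by
  have hS := LinearMap.shortExact_shortComplexKer hπ
  have : Module.Flat A π.shortComplexKer.X₂ := inferInstanceAs (Module.Flat A F)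
  have h := length_tor_one_add_length_tensor hS (ModuleCat.of A (A ⧸ (maximalIdeal A) ^ n))
  rw [length_tensorObj_quotient_pow, length_tensorObj_quotient_pow,
    length_tensorObj_quotient_pow] at h
  exact h

end TorOneLength

/-- Let `(A,𝔪)` be a Cohen–Macaulay Noetherian local ring of dimension `d ≥ 1` and `M` a
finitely generated non-free `A`-module.  Then `n ↦ length_A (Tor₁^A(M, A/𝔪^{n+1}))` is, for all large
`n`, given by a polynomial in `n` of degree exactly `d - 1`. -/
theorem torOneLength_eventually_polynomial_of_degree_eq
    (A : Type) [CommRing A] [IsNoetherianRing A] [IsLocalRing A]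
    (d : ℕ) (hd : 1 ≤ d)
    (hdim : ringKrullDim A = d)
    (hdepth : seqDepth A A (maximalIdeal A) = d)
    (M : Type) [AddCommGroup M] [Module A M] [Module.Finite A M] (hnotfree : ¬ Module.Free A M) :
    ∃ (p : Polynomial ℚ) (N : ℕ), p.degree = (d - 1 : ℕ) ∧
      ∀ n : ℕ, N ≤ n → ∃ ln : ℕ,
        torOneLength A M n = (ln : WithBot ℕ∞) ∧ (ln : ℚ) = p.eval (n : ℚ) := by
  obtain ⟨e, rfl⟩ := Nat.exists_eq_add_of_le' hd
  obtain ⟨rs, hlen, hmem, hreg⟩ := seqDepth.exists_isRegular hdepth hd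
  obtain ⟨r, π, hπ, hmin⟩ := exists_surjective_ker_le_maximalIdeal_smul (R := A) (M := M)
  have hker : LinearMap.ker π ≠ ⊥ := fun h => hnotfree
    (Module.Free.of_equiv (LinearEquiv.ofBijective π ⟨LinearMap.ker_eq_bot.mp h, hπ⟩))
  obtain ⟨p, hp, hpT⟩ := exists_eventuallyEval_of_add_hilbertSamuel_eq hdim hπ hmin
    (fun p hp => hlen ▸ hreg.toIsWeaklyRegular.length_le_degree_of_submodule_pi hdim hmem hker hp)
    (fun n => length_tor_one_add_hilbertSamuel hπ (n + 1))
  obtain ⟨N, hN⟩ := Filter.eventually_atTop.mp hpT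
  refine ⟨p, N, hp, fun n hn => ?_⟩
  obtain ⟨k, hk, hkp⟩ := hN n hn
  refine ⟨k, ?_, hkp⟩
  rw [torOneLength, moduleLength, ← Module.coe_length]
  exact congrArg WithBot.some hk
end
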